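/- Let λ be a multiset of positive integers with sum k_λ in which every element is at least 2 (so λ is non-trivial and the multiplicity of 1 in λ is zero). Then there exists a finite simple graph G with chromatic number equal to k_λ and exactly 2k_λ + 3 vertices which is not λ-choosable. -/

import Mathlib

open SimpleGraph

/-- `G` has a proper colouring from the lists `L`. -/
def ListColourable {V : Type*} (G : SimpleGraph V) (L : V → Finset ℕ) : Prop :=
  ∃ f : V → ℕ, (∀ v, f v ∈ L v) ∧ ∀ ⦃u w⦄, G.Adj u w → f u ≠ f w

/-- `L` is a `lam`-list assignment: the elements `k_1, …, k_q` of the multiset `lam`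
can be enumerated by a list `l`, and there are pairwise disjoint colour sets
`C 1, …, C q` such that `|L v ∩ C i| ≥ k_i` for every vertex `v` and every `i`. -/
def IsLamAssignment {V : Type*} (lam : Multiset ℕ) (L : V → Finset ℕ) : Prop :=
  ∃ (l : List ℕ) (C : Fin l.length → Finset ℕ),
    (l : Multiset ℕ) = lam ∧
    (∀ i j, i ≠ j → Disjoint (C i) (C j)) ∧
    ∀ (v : V) (i : Fin l.length), l.get i ≤ ((L v) ∩ C i).card

/-- `G` is `lam`-choosable. -/
def LamChoosable {V : Type*} (G : SimpleGraph V) (lam : Multiset ℕ) : Prop :=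
  ∀ L : V → Finset ℕ, IsLamAssignment lam L → ListColourable G L

/-- The part containing a vertex of the complete multipartite graph `K_{5, 2, …, 2}` with `r` parts
of size two; `none` is the part of size five. -/
def fiveTwosPart (r : ℕ) : Fin 5 ⊕ Fin r × Bool → Option (Fin r) :=
  Sum.elim (fun _ => none) (fun v => some v.1)

lemma fiveTwosPart_surjective (r : ℕ) : Function.Surjective (fiveTwosPart r) := by
  rintro (_ | i)
  · exact ⟨Sum.inl 0, rfl⟩
  · exact ⟨Sum.inr (i, false), rfl⟩

lemma chromaticNumber_comap_top_of_surjective {V W : Type*} [Fintype W] {p : V → W}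
    (hp : Function.Surjective p) :
    ((⊤ : SimpleGraph W).comap p).chromaticNumber = Fintype.card W := by
  classical
  obtain ⟨s, hs⟩ := hp.hasRightInverse
  apply le_antisymm
  · exact (Coloring.mk p fun h => h : ((⊤ : SimpleGraph W).comap p).Coloring W)
      |>.colorable.chromaticNumber_le
  · rw [← chromaticNumber_top (V := W)]
    let e : (⊤ : SimpleGraph W) →g (⊤ : SimpleGraph W).comap p :=
      ⟨s, fun {a b} h => by simpa [hs a, hs b] using h⟩
    exact chromaticNumber_mono_of_hom e

/-- An injection into a type with exactly one more element misses only one element. -/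
lemma exists_forall_ne_mem_range {α β : Type*} [Fintype α] [Fintype β] {g : α → β}
    (hg : Function.Injective g) (hc : Fintype.card β = Fintype.card α + 1) :
    ∃ x, ∀ z, z ≠ x → ∃ a, g a = z := by
  classical
  have h : (Finset.univ.image g)ᶜ.card = 1 := by
    rw [Finset.card_compl, Finset.card_image_of_injective _ hg, hc, Finset.card_univ]
    omega
  obtain ⟨x, hx⟩ := Finset.card_eq_one.1 h
  refine ⟨x, fun z hz => ?_⟩
  by_contra hne
  have : z ∈ (Finset.univ.image g)ᶜ := by simpa using hne
  rw [hx, Finset.mem_singleton] at this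
  exact hz this

/-- In a proper colouring of `K_{5, 2, …, 2}` whose two-vertex parts have lists `K × {false}` and
`K × {true}`, these parts use all but one colour of each kind. So there is no such colouring if
every pair of such colours is avoided by a list on the part of size five. -/
lemma no_colouring_of_forall_pair_avoided {K : Type*} [Fintype K] {r : ℕ}
    (hK : Fintype.card K = r + 1) (S : Fin 5 → Bool → K → Prop)
    (hS : ∀ x y, ∃ j, ¬ S j false x ∧ ¬ S j true y)
    (f : Fin 5 ⊕ Fin r × Bool → K × Bool)
    (hf₅ : ∀ j, S j (f (Sum.inl j)).2 (f (Sum.inl j)).1)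
    (hf₂ : ∀ i b, (f (Sum.inr (i, b))).2 = b)
    (hf : ∀ u w, fiveTwosPart r u ≠ fiveTwosPart r w → f u ≠ f w) : False := by
  have hmiss (b : Bool) : ∃ x, ∀ z, z ≠ x → ∃ i, (f (Sum.inr (i, b))).1 = z := by
    apply exists_forall_ne_mem_range _ (by simpa using hK)
    intro i i' h
    by_contra hne
    exact hf (Sum.inr (i, b)) (Sum.inr (i', b)) (by simpa [fiveTwosPart] using hne)
      (Prod.ext h (by rw [hf₂, hf₂]))
  choose x hx using hmiss
  obtain ⟨j, hj⟩ := hS (x false) (x true)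
  have hne : (f (Sum.inl j)).1 ≠ x (f (Sum.inl j)).2 := by
    intro h
    have := hf₅ j
    rw [h] at this
    cases hb : (f (Sum.inl j)).2 <;> rw [hb] at this
    · exact hj.1 this
    · exact hj.2 this
  obtain ⟨i, hi⟩ := hx _ _ hne
  exact hf (Sum.inr (i, _)) (Sum.inl j) (by simp [fiveTwosPart]) (Prod.ext hi (hf₂ _ _))

/-- The lists on the part of size five within one colour class: `fiveList m j b p` says that the
`p`-th colour of kind `b` belongs to the `j`-th list, where `m` is half the size of the class. -/
def fiveList (m : ℕ) (j : Fin 5) (b : Bool) (p : ℕ) : Prop :=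
  match j, b with
  | 0, _ => m ≤ p
  | 1, false => m ≤ p
  | 1, true => p < m
  | 2, false => p < m
  | 2, true => m ≤ p
  | 3, false => p ≤ m
  | 3, true => p < m
  | 4, false => p ≠ m
  | 4, true => p < m

lemma exists_not_fiveList (m m' p q : ℕ) :
    ∃ j, ¬ fiveList m j false p ∧ ¬ fiveList m' j true q := by
  rcases lt_trichotomy p m with hp | hp | hp <;> rcases lt_or_ge q m' with hq | hq
  · exact ⟨0, by simp [fiveList]; omega⟩
  · exact ⟨1, by simp [fiveList]; omega⟩
  · exact ⟨2, by simp [fiveList]; omega⟩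
  · exact ⟨4, by simp [fiveList]; omega⟩
  · exact ⟨2, by simp [fiveList]; omega⟩
  · exact ⟨3, by simp [fiveList]; omega⟩

/-- An injective choice of colours in the `j`-th list; see `fiveList_fiveListChoice`. -/
def fiveListChoice (m : ℕ) (j : Fin 5) (p : ℕ) : ℕ × Bool :=
  match j with
  | 0 => if m ≤ p then (p, false) else (p + m, true)
  | 1 => if m ≤ p then (p, false) else (p, true)
  | 2 => if p < m then (p, false) else (p, true)
  | 3 => if p ≤ m then (p, false) else (p - m - 1, true)
  | 4 => if p ≠ m then (p, false) else (0, true)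

lemma fiveListChoice_injective (m : ℕ) (j : Fin 5) : Function.Injective (fiveListChoice m j) := by
  intro p q h
  fin_cases j <;> simp only [fiveListChoice] at h <;> split_ifs at h <;>
    simp only [Prod.mk.injEq, reduceCtorEq, and_true, and_false] at h <;> omega

lemma fiveListChoice_lt {k p : ℕ} (hp : p < k) (j : Fin 5) :
    (fiveListChoice (k / 2) j p).1 < k := by
  fin_cases j <;> simp only [fiveListChoice] <;> split_ifs <;> simp only <;> omega

lemma fiveList_fiveListChoice {k p : ℕ} (hk : 2 ≤ k) (hp : p < k) (j : Fin 5) :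
    fiveList (k / 2) j (fiveListChoice (k / 2) j p).2 (fiveListChoice (k / 2) j p).1 := by
  fin_cases j <;> simp only [fiveListChoice] <;> split_ifs <;> simp only [fiveList] <;> omega

section Lists

variable {n : ℕ} (k : Fin n → ℕ)

/-- The colours: `k i` colours of each of two kinds in the `i`-th class. -/
abbrev ClassColour : Type := (Σ i, Fin (k i)) × Bool

/-- The condition for a colour to be in the list of a vertex of `K_{5, 2, …, 2}`. -/
def InList {r : ℕ} (v : Fin 5 ⊕ Fin r × Bool) (c : ClassColour k) : Prop :=
  match v with
  | Sum.inl j => fiveList (k c.1.1 / 2) j c.2 c.1.2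
  | Sum.inr (_, b) => c.2 = b

lemma exists_injective_inList (hk : ∀ i, 2 ≤ k i) {r : ℕ} (v : Fin 5 ⊕ Fin r × Bool) (i : Fin n) :
    ∃ g : Fin (k i) → ClassColour k, Function.Injective g ∧
      ∀ p, InList k v (g p) ∧ (g p).1.1 = i := by
  rcases v with j | ⟨_, b⟩
  · refine ⟨fun p => (⟨i, ⟨_, fiveListChoice_lt p.2 j⟩⟩, (fiveListChoice (k i / 2) j p).2), ?_,
      fun p => ⟨fiveList_fiveListChoice (hk i) p.2 j, rfl⟩⟩
    intro p q h
    simp only [Prod.mk.injEq, Sigma.mk.injEq, heq_eq_eq, true_and, Fin.mk.injEq] at h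
    exact Fin.ext (fiveListChoice_injective _ j (Prod.ext h.1 h.2))
  · refine ⟨fun p => (⟨i, p⟩, b), ?_, fun p => ⟨rfl, rfl⟩⟩
    intro p q h
    simpa using h

open Classical in
/-- The list assignment with colours encoded as natural numbers. -/
noncomputable def encodedList {r : ℕ} (v : Fin 5 ⊕ Fin r × Bool) : Finset ℕ :=
  (Finset.univ.filter (InList k v)).image Encodable.encode

open Classical in
/-- The colours of the `i`-th class, encoded as natural numbers. -/
noncomputable def encodedClass (i : Fin n) : Finset ℕ :=
  (Finset.univ.filter fun c : ClassColour k => c.1.1 = i).image Encodable.encode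

lemma disjoint_encodedClass {i j : Fin n} (h : i ≠ j) :
    Disjoint (encodedClass k i) (encodedClass k j) := by
  rw [encodedClass, encodedClass, Finset.disjoint_image Encodable.encode_injective,
    Finset.disjoint_filter]
  rintro c _ rfl
  exact h

lemma le_card_encodedList_inter_encodedClass (hk : ∀ i, 2 ≤ k i) {r : ℕ}
    (v : Fin 5 ⊕ Fin r × Bool) (i : Fin n) :
    k i ≤ (encodedList k v ∩ encodedClass k i).card := by
  obtain ⟨g, hg, hgv⟩ := exists_injective_inList k hk v i
  calc k i = (Finset.univ.image (Encodable.encode ∘ g)).card := by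
        rw [Finset.card_image_of_injective _ (Encodable.encode_injective.comp hg)]
        simp
    _ ≤ _ := by
        refine Finset.card_le_card fun a ha => ?_
        obtain ⟨p, _, rfl⟩ := Finset.mem_image.1 ha
        rw [Finset.mem_inter, encodedList, encodedClass]
        exact ⟨Finset.mem_image_of_mem _ (by simpa using (hgv p).1),
          Finset.mem_image_of_mem _ (by simpa using (hgv p).2)⟩

lemma not_colouring_encodedList {r : ℕ} (hr : ∑ i, k i = r + 1) (f : Fin 5 ⊕ Fin r × Bool → ℕ)
    (hfL : ∀ v, f v ∈ encodedList k v) :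
    ¬ ∀ u w, fiveTwosPart r u ≠ fiveTwosPart r w → f u ≠ f w := by
  intro hf
  have hc (v) : ∃ c : ClassColour k, InList k v c ∧ Encodable.encode c = f v := by
    simpa only [encodedList, Finset.mem_image, Finset.mem_filter, Finset.mem_univ, true_and]
      using hfL v
  choose c hcL hcf using hc
  refine no_colouring_of_forall_pair_avoided (by simpa using hr)
    (fun j b (x : Σ i, Fin (k i)) => fiveList (k x.1 / 2) j b x.2)
    (fun x y => exists_not_fiveList _ _ _ _) c (fun j => hcL (Sum.inl j))
    (fun i b => hcL (Sum.inr (i, b))) fun u w huw h => hf u w huw ?_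
  rw [← hcf, ← hcf, h]

end Lists

theorem exists_non_choosable_graph_no_ones (lam : Multiset ℕ)
    (hlam : lam ≠ 0) (h2 : ∀ x ∈ lam, 2 ≤ x) :
    ∃ G : SimpleGraph (Fin (2 * lam.sum + 3)),
      G.chromaticNumber = (lam.sum : ℕ∞) ∧ ¬ LamChoosable G lam := by
  obtain ⟨r, hr⟩ : ∃ r, lam.sum = r + 1 := by
    obtain ⟨x, hx⟩ := Multiset.exists_mem_of_ne_zero hlam
    exact Nat.exists_eq_add_of_le' (by have := Multiset.le_sum_of_mem hx; have := h2 x hx; omega)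
  have hsum : ∑ i, lam.toList.get i = r + 1 := by
    rw [← hr, ← lam.sum_toList]
    simp [Fin.sum_univ_getElem]
  let e : Fin (2 * lam.sum + 3) ≃ Fin 5 ⊕ Fin r × Bool :=
    Fintype.equivOfCardEq (by simp [hr]; ring)
  refine ⟨(⊤ : SimpleGraph (Option (Fin r))).comap (fiveTwosPart r ∘ e), ?_, fun hch => ?_⟩
  · rw [chromaticNumber_comap_top_of_surjective ((fiveTwosPart_surjective r).comp e.surjective)]
    simp [hr]
  · obtain ⟨f, hfL, hf⟩ := hch (fun v => encodedList lam.toList.get (e v))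
      ⟨lam.toList, encodedClass lam.toList.get, lam.coe_toList,
        fun _ _ => disjoint_encodedClass _,
        fun v => le_card_encodedList_inter_encodedClass _
          (fun i => h2 _ (Multiset.mem_toList.1 (List.get_mem _ i))) (e v)⟩
    refine not_colouring_encodedList lam.toList.get hsum (f ∘ e.symm)
      (fun v => by simpa using hfL (e.symm v)) fun u w huw => hf ?_
    simpa using huw
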